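/- arXiv:math/0506216 — 4 statements merged into one kernel-verified Lean document; each statement's English description precedes it below -/
import Mathlib

section
/- Let X be a finite connected graph without any terminal vertex, and let ∼ be the equivalence relation on its oriented edge set E generated by relating e to f whenever ρ_{ef} = 1. Then for any two oriented edges e, f ∈ E, either e ∼ f or e ∼ f̄. -/
/-- A finite graph in the sense of Serre: oriented edges with a fixed-point-free
involution `bar`, and initial/terminal vertex maps `i`, `t`. -/
structure SerreGraph (V E : Type) where
  bar : E → E
  bar_bar : ∀ e, bar (bar e) = e
  bar_ne : ∀ e, bar e ≠ e
  i : E → V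
  t : E → V
  i_bar : ∀ e, i (bar e) = t e
  t_bar : ∀ e, t (bar e) = i e

namespace SerreGraph

variable {V E : Type}

/-- `rho G e f = 1` iff `ef` is a combinatorial path without backtracking. -/
def rho [DecidableEq V] [DecidableEq E] (G : SerreGraph V E) (e f : E) : ℝ :=
  if G.t e = G.i f ∧ G.bar e ≠ f then 1 else 0

/-- The edge adjacency matrix of the graph. -/
def adjMatrix [DecidableEq V] [DecidableEq E] (G : SerreGraph V E) : Matrix E E ℝ :=
  fun e f => G.rho e f

/-- The valency of a vertex: the number of edges with initial vertex `x`. -/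
noncomputable def valency (G : SerreGraph V E) (x : V) : ℕ :=
  Nat.card {e : E // G.i e = x}

/-- `G.k x` is the valency of `x` minus one. -/
noncomputable def k (G : SerreGraph V E) (x : V) : ℕ :=
  G.valency x - 1

/-- The graph is connected: the equivalence relation on vertices generated by
relating `i e` to `t e` has a single class. -/
def Connected (G : SerreGraph V E) : Prop :=
  ∀ x y : V, Relation.EqvGen (fun a b => ∃ e : E, G.i e = a ∧ G.t e = b) x y

/-- A nonnegative square matrix is reducible if the index set splits into two
nonempty complementary subsets with all entries between them vanishing. -/
def MatReducible (M : Matrix E E ℝ) : Prop :=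
  ∃ U : Set E, U.Nonempty ∧ Uᶜ.Nonempty ∧ ∀ u ∈ U, ∀ v ∈ Uᶜ, M u v = 0 ∧ M v u = 0

/-- A matrix is irreducible if it is not reducible. -/
def MatIrreducible (M : Matrix E E ℝ) : Prop :=
  ¬ MatReducible M

/-- A length function: positive and invariant under the edge involution. -/
def IsLengthFunction (G : SerreGraph V E) (ℓ : E → ℝ) : Prop :=
  (∀ e, 0 < ℓ e) ∧ ∀ e, ℓ (G.bar e) = ℓ e

end SerreGraph

namespace SerreGraph

variable {V E : Type}

theorem exists_i_eq_of_valency_pos (G : SerreGraph V E) {x : V} (h : 0 < G.valency x) :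
    ∃ e, G.i e = x := by
  obtain ⟨⟨e, he⟩⟩ := (Nat.card_pos_iff.mp h).1
  exact ⟨e, he⟩

variable [DecidableEq V] [DecidableEq E]

/-- Reversing a non-backtracking path of length two. -/
theorem rho_bar_bar (G : SerreGraph V E) {e f : E} (h : G.rho e f = 1) :
    G.rho (G.bar f) (G.bar e) = 1 := by
  unfold rho at h ⊢
  split_ifs at h with hc
  · rw [if_pos]
    refine ⟨by rw [G.t_bar, G.i_bar, hc.1], ?_⟩
    rw [G.bar_bar]
    exact hc.2.symm
  · exact absurd h zero_ne_one

/-- The equivalence relation generated by `rho e f = 1`. -/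
def PathRel (G : SerreGraph V E) : E → E → Prop :=
  Relation.EqvGen (fun a b => G.rho a b = 1)

theorem PathRel.bar {G : SerreGraph V E} {e f : E} (h : G.PathRel e f) :
    G.PathRel (G.bar e) (G.bar f) := by
  induction h with
  | rel a b h => exact .symm _ _ (.rel _ _ (G.rho_bar_bar h))
  | refl a => exact .refl _
  | symm a b _ ih => exact .symm _ _ ih
  | trans a b c _ _ ih₁ ih₂ => exact .trans _ _ _ ih₁ ih₂

/-- The relation `e ∼ f` or `e ∼ f̄`. -/
def UnorientedPathRel (G : SerreGraph V E) (e f : E) : Prop :=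
  G.PathRel e f ∨ G.PathRel e (G.bar f)

namespace UnorientedPathRel

variable {G : SerreGraph V E} {e f g : E}

theorem symm (h : G.UnorientedPathRel e f) : G.UnorientedPathRel f e := by
  rcases h with h | h
  · exact .inl (.symm _ _ h)
  · have h' := h.bar
    rw [G.bar_bar] at h'
    exact .inr (.symm _ _ h')

theorem trans (h₁ : G.UnorientedPathRel e f) (h₂ : G.UnorientedPathRel f g) :
    G.UnorientedPathRel e g := by
  rcases h₁ with h₁ | h₁ <;> rcases h₂ with h₂ | h₂
  · exact .inl (.trans _ _ _ h₁ h₂)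
  · exact .inr (.trans _ _ _ h₁ h₂)
  · exact .inr (.trans _ _ _ h₁ h₂.bar)
  · have h' := h₂.bar
    rw [G.bar_bar] at h'
    exact .inl (.trans _ _ _ h₁ h')

theorem self_bar (G : SerreGraph V E) (e : E) : G.UnorientedPathRel e (G.bar e) := by
  refine .inr ?_
  rw [G.bar_bar]
  exact .refl _

theorem of_i_eq (h : G.i e = G.i f) : G.UnorientedPathRel e f := by
  by_cases hef : e = f
  · subst hef
    exact .inl (.refl _)
  · refine (self_bar G e).trans (.inl (.rel _ _ ?_))
    rw [rho, if_pos]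
    exact ⟨by rw [G.t_bar, h], by rwa [G.bar_bar]⟩

end UnorientedPathRel

theorem Connected.unorientedPathRel {G : SerreGraph V E} (hconn : G.Connected)
    (hval : ∀ x, 0 < G.valency x) (e f : E) : G.UnorientedPathRel e f := by
  suffices H : ∀ x y, Relation.EqvGen (fun a b => ∃ e : E, G.i e = a ∧ G.t e = b) x y →
      ∀ a b, G.i a = x → G.i b = y → G.UnorientedPathRel a b from
    H _ _ (hconn _ _) e f rfl rfl
  intro x y h
  induction h with
  | rel x y h =>
    obtain ⟨c, rfl, rfl⟩ := h
    intro a b ha hb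
    exact ((UnorientedPathRel.of_i_eq ha).trans (.self_bar G c)).trans
      (.of_i_eq (by rw [G.i_bar, hb]))
  | refl x =>
    intro a b ha hb
    exact .of_i_eq (ha.trans hb.symm)
  | symm x y _ ih => exact fun a b ha hb => (ih b a hb ha).symm
  | trans x y z _ _ ih₁ ih₂ =>
    intro a b ha hb
    obtain ⟨c, hc⟩ := G.exists_i_eq_of_valency_pos (hval y)
    exact (ih₁ a c ha hc).trans (ih₂ c b hc hb)

end SerreGraph

open SerreGraph in
/-- In a finite connected graph without terminal vertices, any two oriented edges
`e, f` satisfy `e ∼ f` or `e ∼ f̄`, where `∼` is the equivalence relation on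
oriented edges generated by `ρ_{ef} = 1`. -/
theorem eqvGen_edge_or_bar
    {V E : Type} [Fintype V] [Fintype E] [DecidableEq V] [DecidableEq E]
    (G : SerreGraph V E) (hconn : G.Connected)
    (hval : ∀ x : V, 2 ≤ G.valency x) (e f : E) :
    Relation.EqvGen (fun a b => G.rho a b = 1) e f ∨
      Relation.EqvGen (fun a b => G.rho a b = 1) e (G.bar f) := by
  exact hconn.unorientedPathRel (fun x => Nat.zero_lt_of_lt (hval x)) e f
end

section
/- Let X be a finite connected graph without any terminal vertex which is not a cycle (every vertex has valency at least 2 and some vertex has valency at least 3), and let ℓ be a length function on X. If h₁ > 0 and h₂ > 0 are real numbers such that for each j ∈ {1,2} there exists a vector (x_e)_{e∈E} with all entries positive satisfying x_e = Σ_{f∈E} ρ_{ef} e^{−h_j ℓ(f)} x_f for all e ∈ E, then h₁ = h₂. (This unique h equals the volume entropy of the metric graph (X, d_ℓ).) -/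
namespace SerreGraph

theorem rho_nonneg {V E : Type} [DecidableEq V] [DecidableEq E] (G : SerreGraph V E) (e f : E) :
    0 ≤ G.rho e f := by
  unfold rho
  split_ifs <;> norm_num

/-- Comparing two positive solutions at an edge where their ratio is maximal shows that
the larger exponent cannot occur. -/
theorem not_lt_of_positive_solutions {V E : Type} [Fintype E] [Nonempty E]
    [DecidableEq V] [DecidableEq E] (G : SerreGraph V E) {ℓ : E → ℝ} (hℓ : ∀ e, 0 < ℓ e)
    {a b : ℝ} {x y : E → ℝ} (hx : ∀ e, 0 < x e) (hy : ∀ e, 0 < y e)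
    (hxa : ∀ e, x e = ∑ f : E, G.rho e f * Real.exp (-a * ℓ f) * x f)
    (hyb : ∀ e, y e = ∑ f : E, G.rho e f * Real.exp (-b * ℓ f) * y f) : ¬ a < b := by
  intro hab
  obtain ⟨e, he⟩ := Finite.exists_max fun f => y f / x f
  set c := y e / x e with hc
  have hc_pos : 0 < c := div_pos (hy e) (hx e)
  have hyx : ∀ f, y f ≤ c * x f := fun f => (div_le_iff₀ (hx f)).1 (he f)
  have hexp : ∀ f, Real.exp (-b * ℓ f) < Real.exp (-a * ℓ f) := fun f => by
    rw [Real.exp_lt_exp]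
    nlinarith [mul_lt_mul_of_pos_right hab (hℓ f)]
  have hterm : ∀ f, Real.exp (-b * ℓ f) * y f < Real.exp (-a * ℓ f) * (c * x f) := fun f =>
    mul_lt_mul (hexp f) (hyx f) (hy f) (Real.exp_pos _).le
  obtain ⟨g, -, hg⟩ : ∃ g ∈ Finset.univ, G.rho e g * Real.exp (-b * ℓ g) * y g ≠ 0 :=
    Finset.exists_ne_zero_of_sum_ne_zero (hyb e ▸ (hy e).ne')
  have hrho : 0 < G.rho e g :=
    (G.rho_nonneg e g).lt_of_ne' fun h => hg (by rw [h, zero_mul, zero_mul])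
  have hlt : y e < c * x e := by
    rw [hxa e, hyb e, Finset.mul_sum]
    refine Finset.sum_lt_sum (fun f _ => ?_) ⟨g, Finset.mem_univ g, ?_⟩
    · nlinarith [mul_le_mul_of_nonneg_left (hterm f).le (G.rho_nonneg e f)]
    · nlinarith [mul_lt_mul_of_pos_left (hterm g) hrho]
  rw [hc, div_mul_cancel₀ _ (hx e).ne'] at hlt
  exact lt_irrefl _ hlt

end SerreGraph

open SerreGraph in
/-- Uniqueness: for a finite connected graph without terminal vertices which is
not a cycle, with a length function `ℓ`, the positive constant `h` for which the
system `x_e = Σ_f ρ_{ef} e^{-h ℓ(f)} x_f` admits a positive solution is unique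
(it is the volume entropy of `(X, d_ℓ)`). -/
theorem entropy_unique
    {V E : Type} [Fintype V] [Fintype E] [DecidableEq V] [DecidableEq E]
    (G : SerreGraph V E) (hconn : G.Connected)
    (hval : ∀ x : V, 2 ≤ G.valency x) (hbig : ∃ x : V, 3 ≤ G.valency x)
    (ℓ : E → ℝ) (hℓ : G.IsLengthFunction ℓ)
    (h₁ h₂ : ℝ) (h₁pos : 0 < h₁) (h₂pos : 0 < h₂)
    (hx₁ : ∃ x : E → ℝ, (∀ e, 0 < x e) ∧
      ∀ e : E, x e = ∑ f : E, G.rho e f * Real.exp (-h₁ * ℓ f) * x f)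
    (hx₂ : ∃ x : E → ℝ, (∀ e, 0 < x e) ∧
      ∀ e : E, x e = ∑ f : E, G.rho e f * Real.exp (-h₂ * ℓ f) * x f) :
    h₁ = h₂ := by
  obtain ⟨v, hv⟩ := hbig
  have : Nonempty E := by
    by_contra h
    rw [not_nonempty_iff] at h
    simp [valency] at hv
  obtain ⟨x, hx, hxeq⟩ := hx₁
  obtain ⟨y, hy, hyeq⟩ := hx₂
  exact le_antisymm
    (not_lt.1 (G.not_lt_of_positive_solutions hℓ.1 hy hx hyeq hxeq))
    (not_lt.1 (G.not_lt_of_positive_solutions hℓ.1 hx hy hxeq hyeq))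
end

section
/- Let X be a finite connected graph in which every vertex x has valency k_x + 1 at least 3 (so k_x ≥ 2). Let ℓ be a normalized length function on X (so Σ_{e∈E} ℓ(e) = 2), let h > 0, and suppose there is a vector (x_e)_{e∈E} with all entries positive satisfying x_e = Σ_{f∈E} ρ_{ef} e^{−h ℓ(f)} x_f for all e ∈ E. Then h ≥ (1/2) Σ_{x∈V} (k_x + 1) log k_x. -/
namespace SerreGraph

variable {V E : Type} [Fintype E] [DecidableEq V]

theorem sum_terminal (G : SerreGraph V E) [Fintype V] (hk : ∀ v, G.k v ≠ 0) (φ : V → ℝ) :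
    ∑ e, φ (G.t e) = ∑ v, ((G.k v : ℝ) + 1) * φ v := by
  have hbar : ∑ e, φ (G.t e) = ∑ e, φ (G.i e) :=
    Fintype.sum_bijective G.bar (Function.Involutive.bijective G.bar_bar) _ _
      fun e => by rw [G.i_bar]
  rw [hbar, ← Finset.sum_fiberwise Finset.univ G.i]
  refine Finset.sum_congr rfl fun v _ => ?_
  rw [Finset.sum_congr rfl fun e he => by rw [(Finset.mem_filter.1 he).2], Finset.sum_const,
    nsmul_eq_mul]
  congr 1
  have h1 : (Finset.univ.filter fun e => G.i e = v).card = G.k v + 1 := by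
    have := hk v
    rw [k, valency, Nat.card_eq_fintype_card, Fintype.card_subtype] at *
    omega
  rw [h1]
  push_cast
  rfl

variable [DecidableEq E]

theorem card_erase_star (G : SerreGraph V E) (e : E) :
    ((Finset.univ.filter fun f => G.i f = G.i e).erase e).card = G.k (G.i e) := by
  rw [Finset.card_erase_of_mem (by simp), k, valency, Nat.card_eq_fintype_card,
    Fintype.card_subtype]

/-- The edges that may follow `e` in a path without backtracking. -/
def next (G : SerreGraph V E) (e : E) : Finset E :=
  Finset.univ.filter fun f => G.t e = G.i f ∧ G.bar e ≠ f

theorem mem_next (G : SerreGraph V E) {e f : E} :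
    f ∈ G.next e ↔ G.t e = G.i f ∧ G.bar e ≠ f := by
  simp [next]

theorem card_next (G : SerreGraph V E) (e : E) : (G.next e).card = G.k (G.t e) := by
  rw [← G.i_bar, ← G.card_erase_star]
  congr 1
  ext f
  simp only [mem_next, Finset.mem_erase, Finset.mem_filter, Finset.mem_univ, true_and, G.i_bar]
  tauto

theorem card_filter_mem_next (G : SerreGraph V E) (f : E) :
    (Finset.univ.filter fun e => f ∈ G.next e).card = G.k (G.i f) := by
  rw [← G.card_erase_star]
  refine Finset.card_nbij' G.bar G.bar ?_ ?_ (fun e _ => G.bar_bar e) (fun e _ => G.bar_bar e)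
  · intro e he
    have := G.mem_next.1 (Finset.mem_filter.1 he).2
    simpa [G.i_bar, this.1] using this.2
  · intro e he
    have := Finset.mem_erase.1 he
    simpa [mem_next, G.t_bar, G.bar_bar, eq_comm, and_comm] using this

/-- Averaging over the successors of an edge preserves the total sum. -/
theorem sum_average_next (G : SerreGraph V E) (hk : ∀ v, G.k v ≠ 0) (g : E → ℝ) :
    ∑ e, (∑ f ∈ G.next e, g f) / (G.k (G.t e) : ℝ) = ∑ f, g f := by
  simp_rw [Finset.sum_div]
  rw [Finset.sum_comm' (t' := Finset.univ)
    (s' := fun f => Finset.univ.filter fun e => f ∈ G.next e) (by simp)]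
  refine Finset.sum_congr rfl fun f _ => ?_
  have hc : ∀ e ∈ Finset.univ.filter (fun e => f ∈ G.next e),
      g f / (G.k (G.t e) : ℝ) = g f / (G.k (G.i f) : ℝ) := fun e he => by
    rw [(G.mem_next.1 (Finset.mem_filter.1 he).2).1]
  rw [Finset.sum_congr rfl hc, Finset.sum_const, card_filter_mem_next, nsmul_eq_mul]
  exact mul_div_cancel₀ _ (Nat.cast_ne_zero.2 (hk _))

end SerreGraph

/-- The inequality of arithmetic and geometric means, in logarithmic form. -/
theorem log_card_add_average_log_le {ι : Type*} {s : Finset ι} (hs : s.Nonempty) {y : ι → ℝ}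
    (hy : ∀ f ∈ s, 0 < y f) :
    Real.log s.card + (∑ f ∈ s, Real.log (y f)) / s.card ≤ Real.log (∑ f ∈ s, y f) := by
  have hn : (0 : ℝ) < s.card := by exact_mod_cast hs.card_pos
  have hS : 0 < ∑ f ∈ s, y f := Finset.sum_pos hy hs
  set m := (∑ f ∈ s, y f) / s.card with hm
  have hm0 : 0 < m := div_pos hS hn
  have key : ∑ f ∈ s, Real.log (y f) ≤ ∑ f ∈ s, (Real.log m + (y f / m - 1)) :=
    Finset.sum_le_sum fun f hf => by
      have := Real.log_le_sub_one_of_pos (div_pos (hy f hf) hm0)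
      rw [Real.log_div (hy f hf).ne' hm0.ne'] at this
      linarith
  have hrhs : ∑ f ∈ s, (Real.log m + (y f / m - 1)) = Real.log m * s.card := by
    rw [Finset.sum_add_distrib, Finset.sum_sub_distrib, ← Finset.sum_div, Finset.sum_const,
      Finset.sum_const, nsmul_eq_mul, nsmul_eq_mul, hm, div_div_cancel₀ hS.ne']
    ring
  rw [hrhs, ← div_le_iff₀ hn, hm, Real.log_div hS.ne' hn.ne'] at key
  linarith

open SerreGraph in
/-- Lower bound on the volume entropy: if every vertex has valency `k_x + 1 ≥ 3`,
`ℓ` is a normalized length function and `h > 0` solves the entropy system, then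
`h ≥ (1/2) Σ_x (k_x + 1) log k_x`. -/
theorem entropy_lower_bound
    {V E : Type} [Fintype V] [Fintype E] [DecidableEq V] [DecidableEq E]
    (G : SerreGraph V E) (hconn : G.Connected)
    (hval : ∀ x : V, 3 ≤ G.valency x)
    (ℓ : E → ℝ) (hℓ : G.IsLengthFunction ℓ) (hnorm : ∑ e : E, ℓ e = 2)
    (h : ℝ) (hpos : 0 < h)
    (hx : ∃ x : E → ℝ, (∀ e, 0 < x e) ∧
      ∀ e : E, x e = ∑ f : E, G.rho e f * Real.exp (-h * ℓ f) * x f) :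
    h ≥ (1 / 2) * ∑ x : V, ((G.k x : ℝ) + 1) * Real.log (G.k x) := by
  obtain ⟨x, hx0, hx⟩ := hx
  have hk : ∀ v, G.k v ≠ 0 := fun v => by
    have := hval v
    unfold SerreGraph.k
    omega
  have hstep : ∀ e, Real.log (G.k (G.t e)) +
      (∑ f ∈ G.next e, (Real.log (x f) - h * ℓ f)) / (G.k (G.t e) : ℝ) ≤ Real.log (x e) := by
    intro e
    have hne : (G.next e).Nonempty := by
      rw [← Finset.card_pos, G.card_next]
      exact Nat.pos_of_ne_zero (hk _)
    have hsum : x e = ∑ f ∈ G.next e, Real.exp (-h * ℓ f) * x f := by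
      rw [hx e, SerreGraph.next, Finset.sum_filter]
      refine Finset.sum_congr rfl fun f _ => ?_
      simp [SerreGraph.rho]
    have hjensen := log_card_add_average_log_le hne
      (fun f _ => mul_pos (Real.exp_pos (-h * ℓ f)) (hx0 f))
    rw [← hsum, G.card_next] at hjensen
    convert hjensen using 4 with f
    rw [Real.log_mul (Real.exp_pos _).ne' (hx0 f).ne', Real.log_exp]
    ring
  have htotal := Finset.sum_le_sum fun e (_ : e ∈ Finset.univ) => hstep e
  rw [Finset.sum_add_distrib, G.sum_average_next hk, Finset.sum_sub_distrib, ← Finset.mul_sum,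
    hnorm, G.sum_terminal hk fun v => Real.log (G.k v)] at htotal
  linarith
end

section
/- Let X be a finite connected graph in which every vertex x has valency k_x + 1 at least 3 (so k_x ≥ 2), and let r = |E|/2 − |V| + 1, where |E| is the number of oriented edges (r is the rank of the free fundamental group of X). Then (1/2) Σ_{x∈V} (k_x + 1) log k_x ≥ 3(r − 1) log 2, with equality if and only if every vertex of X has valency exactly 3. (Consequently, the minimal volume entropy among normalized length functions on graphs with fundamental group free of rank r is attained precisely by trivalent graphs.) -/
namespace SerreGraph

variable {V E : Type}

/-- The handshake identity: the valencies add up to the number of oriented edges. -/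
theorem sum_valency [Fintype V] [Fintype E] [DecidableEq V] (G : SerreGraph V E) :
    ∑ x : V, G.valency x = Fintype.card E := by
  simp only [valency, Nat.card_eq_fintype_card]
  rw [← Fintype.card_sigma]
  exact Fintype.card_congr (Equiv.sigmaFiberEquiv G.i)

end SerreGraph

theorem two_pow_lt_pow_succ_self {k : ℕ} (hk : 3 ≤ k) : 2 ^ (3 * (k - 1)) < k ^ (k + 1) := by
  rcases lt_or_ge k 8 with h | h
  · interval_cases k <;> norm_num
  · rw [pow_mul]
    calc (2 ^ 3) ^ (k - 1) < 8 ^ (k + 1) := Nat.pow_lt_pow_right (by norm_num) (by lia)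
      _ ≤ k ^ (k + 1) := Nat.pow_le_pow_left h _

theorem three_mul_sub_one_mul_log_two_lt {k : ℕ} (hk : 3 ≤ k) :
    3 * ((k : ℝ) - 1) * Real.log 2 < ((k : ℝ) + 1) * Real.log k := by
  have h : ((2 : ℝ) ^ (3 * (k - 1))) < (k : ℝ) ^ (k + 1) := by
    exact_mod_cast two_pow_lt_pow_succ_self hk
  have hlog := Real.log_lt_log (by positivity) h
  rw [Real.log_pow, Real.log_pow] at hlog
  push_cast [Nat.cast_sub (show 1 ≤ k by lia)] at hlog
  exact hlog

theorem three_mul_sub_one_mul_log_two_le {k : ℕ} (hk : 2 ≤ k) :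
    3 * ((k : ℝ) - 1) * Real.log 2 ≤ ((k : ℝ) + 1) * Real.log k := by
  rcases hk.eq_or_lt with rfl | h
  · norm_num
  · exact (three_mul_sub_one_mul_log_two_lt h).le

theorem three_mul_sub_one_mul_log_two_eq_iff {k : ℕ} (hk : 2 ≤ k) :
    3 * ((k : ℝ) - 1) * Real.log 2 = ((k : ℝ) + 1) * Real.log k ↔ k = 2 := by
  constructor
  · intro h
    by_contra hne
    exact (three_mul_sub_one_mul_log_two_lt (by lia)).ne h
  · rintro rfl
    norm_num

open SerreGraph in
/-- For a finite connected graph with every valency `k_x + 1 ≥ 3` and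
`r = |E|/2 - |V| + 1` the rank of its free fundamental group, the minimal volume
entropy `(1/2) Σ_x (k_x + 1) log k_x` is at least `3 (r - 1) log 2`, with equality
iff the graph is trivalent. -/
theorem min_entropy_ge_trivalent
    {V E : Type} [Fintype V] [Fintype E] [DecidableEq V] [DecidableEq E]
    (G : SerreGraph V E) (hconn : G.Connected)
    (hval : ∀ x : V, 3 ≤ G.valency x)
    (r : ℝ) (hr : r = (Fintype.card E : ℝ) / 2 - (Fintype.card V : ℝ) + 1) :
    (1 / 2) * ∑ x : V, ((G.k x : ℝ) + 1) * Real.log (G.k x) ≥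
        3 * (r - 1) * Real.log 2 ∧
      ((1 / 2) * ∑ x : V, ((G.k x : ℝ) + 1) * Real.log (G.k x) =
          3 * (r - 1) * Real.log 2 ↔ ∀ x : V, G.valency x = 3) := by
  have hk : ∀ x, 2 ≤ G.k x := fun x => by have := hval x; unfold k; lia
  have hvk : ∀ x, (G.valency x : ℝ) = G.k x + 1 := fun x => by
    have := hval x
    have h : G.valency x = G.k x + 1 := by unfold k; lia
    exact_mod_cast h
  have hrank : 3 * (r - 1) * Real.log 2 =
      (1 / 2) * ∑ x : V, 3 * ((G.k x : ℝ) - 1) * Real.log 2 := by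
    have hE : (Fintype.card E : ℝ) = ∑ x : V, (G.k x : ℝ) + Fintype.card V := by
      rw [← G.sum_valency, Nat.cast_sum, Finset.sum_congr rfl fun x _ => hvk x]
      simp [Finset.sum_add_distrib]
    rw [← Finset.sum_mul, ← Finset.mul_sum, Finset.sum_sub_distrib, hr, hE]
    simp only [Finset.sum_const, Finset.card_univ, nsmul_eq_mul, mul_one]
    ring
  have hle : ∀ x ∈ Finset.univ, 3 * ((G.k x : ℝ) - 1) * Real.log 2 ≤
      ((G.k x : ℝ) + 1) * Real.log (G.k x) :=
    fun x _ => three_mul_sub_one_mul_log_two_le (hk x)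
  rw [hrank]
  refine ⟨mul_le_mul_of_nonneg_left (Finset.sum_le_sum hle) (by norm_num), ?_⟩
  rw [mul_right_inj' (by norm_num), eq_comm, Finset.sum_eq_sum_iff_of_le hle]
  refine ⟨fun h x => ?_, fun h x _ => ?_⟩
  · have h2 := (three_mul_sub_one_mul_log_two_eq_iff (hk x)).1 (h x (Finset.mem_univ x))
    unfold k at h2
    lia
  · exact (three_mul_sub_one_mul_log_two_eq_iff (hk x)).2 (by simp [k, h x])
end
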